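/- arXiv:math/9702203 — 3 statements merged into one kernel-verified Lean document; each statement's English description precedes it below -/
import Mathlib

section
/- For every regular language L over the symmetric alphabet X = {x^{±1}, y^{±1}, t^{±1}, s^{±1}} all of whose words are geodesic for G, the image of L under the evaluation map does not contain the subgroup of G generated by x, y, t, and s². -/
/-! Generators and presentations for the groups `H` and `G` of Neumann–Shapiro. -/

inductive GenH : Type
  | x | y | t | tau
  deriving DecidableEq

inductive GenG : Type
  | x | y | s | t
  deriving DecidableEq

namespace NS

open FreeGroup

/-- Conjugation `a^b = b⁻¹ a b` in a group. -/
def cnj {Γ : Type*} [Group Γ] (a b : Γ) : Γ := b⁻¹ * a * b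

/-! ### The group `H` -/

abbrev FH := FreeGroup GenH

def fx : FH := FreeGroup.of GenH.x
def fy : FH := FreeGroup.of GenH.y
def ft : FH := FreeGroup.of GenH.t
def ftau : FH := FreeGroup.of GenH.tau

/-- The eight elements `x, x^t, x^τ, x^{tτ}, y, y^t, y^τ, y^{tτ}` (as words). -/
def basisH : List FH :=
  [fx, cnj fx ft, cnj fx ftau, cnj fx (ft * ftau),
   fy, cnj fy ft, cnj fy ftau, cnj fy (ft * ftau)]

/-- Relators of `H`: `t² = τ² = [τ,t] = 1`, the eight elements of `basisH` pairwise
commute, and `x · x^τ = y · y^t`. -/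
def relsH : Set FH :=
  {ft ^ 2, ftau ^ 2, ftau⁻¹ * ft⁻¹ * ftau * ft} ∪
    {r | ∃ a ∈ basisH, ∃ b ∈ basisH, r = a * b * a⁻¹ * b⁻¹} ∪
    {fx * cnj fx ftau * (fy * cnj fy ft)⁻¹}

abbrev H := PresentedGroup relsH

def Hx : H := PresentedGroup.of GenH.x
def Hy : H := PresentedGroup.of GenH.y
def Ht : H := PresentedGroup.of GenH.t
def Htau : H := PresentedGroup.of GenH.tau

/-! ### The group `G` -/

abbrev FG := FreeGroup GenG

def gx : FG := FreeGroup.of GenG.x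
def gy : FG := FreeGroup.of GenG.y
def gs : FG := FreeGroup.of GenG.s
def gt : FG := FreeGroup.of GenG.t

/-- The eight conjugating elements `1, s, s², s³, t, ts, ts², ts³`. -/
def conjsG : List FG := [1, gs, gs ^ 2, gs ^ 3, gt, gt * gs, gt * gs ^ 2, gt * gs ^ 3]

/-- The sixteen elements `x^α, y^α` for `α ∈ {1, s, s², s³, t, ts, ts², ts³}`. -/
def basisG : List FG :=
  conjsG.map (fun b => cnj gx b) ++ conjsG.map (fun b => cnj gy b)

/-- Relators of `G`: `t² = s⁴ = [s,t] = 1`, the sixteen elements of `basisG` pairwise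
commute, and `x · x^{s²} = y · y^t`. -/
def relsG : Set FG :=
  {gt ^ 2, gs ^ 4, gs⁻¹ * gt⁻¹ * gs * gt} ∪
    {r | ∃ a ∈ basisG, ∃ b ∈ basisG, r = a * b * a⁻¹ * b⁻¹} ∪
    {gx * cnj gx (gs ^ 2) * (gy * cnj gy gt)⁻¹}

abbrev G := PresentedGroup relsG

def Gx : G := PresentedGroup.of GenG.x
def Gy : G := PresentedGroup.of GenG.y
def Gs : G := PresentedGroup.of GenG.s
def Gt : G := PresentedGroup.of GenG.t

/-! ### Words, evaluation, lengths, geodesics -/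

/-- A word over the symmetric alphabet on `α`: a letter `(a, true)` stands for the
generator `a` and `(a, false)` for its inverse. -/
abbrev Word (α : Type) := List (α × Bool)

/-- Evaluate a word in a group, given the images of the generators. -/
def evalWith {α : Type} {Γ : Type*} [Group Γ] (f : α → Γ) (w : Word α) : Γ :=
  (w.map fun p => if p.2 then f p.1 else (f p.1)⁻¹).prod

/-- Evaluation of a word over `X_H = {x^{±1}, y^{±1}, t^{±1}, τ^{±1}}` in `H`. -/
def evalH : Word GenH → H := evalWith (fun a => (PresentedGroup.of a : H))

/-- Evaluation of a word over `X = {x^{±1}, y^{±1}, t^{±1}, s^{±1}}` in `G`. -/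
def evalG : Word GenG → G := evalWith (fun a => (PresentedGroup.of a : G))

/-- Weight of a letter for `H`: the letters `x^{±1}, y^{±1}, t^{±1}` have length `1`
and `τ^{±1}` has length `2`. -/
def wtH : GenH × Bool → ℕ
  | (GenH.tau, _) => 2
  | _ => 1

/-- Weighted length of a word over `X_H`. -/
def wlenH (w : Word GenH) : ℕ := (w.map wtH).sum

/-- `ℓ(h)`: the minimum weighted length of a word over `X_H` evaluating to `h`. -/
noncomputable def ellH (h : H) : ℕ := sInf {n | ∃ w : Word GenH, evalH w = h ∧ wlenH w = n}

/-- A word over `X_H` is geodesic if its weighted length is `ℓ` of its evaluation. -/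
def IsGeodesicH (w : Word GenH) : Prop := wlenH w = ellH (evalH w)

/-- `ℓ_G(g)`: the minimum length (number of letters) of a word over `X` evaluating to `g`. -/
noncomputable def ellG (g : G) : ℕ := sInf {n | ∃ w : Word GenG, evalG w = g ∧ w.length = n}

/-- A word over `X` is geodesic if its length is `ℓ_G` of its evaluation. -/
def IsGeodesicG (w : Word GenG) : Prop := w.length = ellG (evalG w)

end NS

namespace NS

/-! ### Positions and weights along a word -/

/-- The finite quotient `⟨s⟩ × ⟨t⟩` of `G`. -/
abbrev Pos := ZMod 4 × ZMod 2

/-- Effect of a letter on the position. -/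
def move (f : Pos) : GenG × Bool → Pos
  | (GenG.s, true) => f + (1, 0)
  | (GenG.s, false) => f + (-1, 0)
  | (GenG.t, _) => f + (0, 1)
  | _ => f

/-- Contribution of a letter read at position `f`, when `x` and `y` have weights `cx` and `cy`. -/
def contrib (cx cy : Pos → ℤ) (f : Pos) : GenG × Bool → ℤ
  | (GenG.x, true) => cx f
  | (GenG.x, false) => -cx f
  | (GenG.y, true) => cy f
  | (GenG.y, false) => -cy f
  | _ => 0

def endpoint (f : Pos) (w : Word GenG) : Pos := w.foldl move f

def weight (cx cy : Pos → ℤ) : Pos → Word GenG → ℤ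
  | _, [] => 0
  | f, l :: w => contrib cx cy f l + weight cx cy (move f l) w

@[simp] lemma endpoint_nil (f : Pos) : endpoint f [] = f := rfl

@[simp] lemma endpoint_cons (f : Pos) (l : GenG × Bool) (w : Word GenG) :
    endpoint f (l :: w) = endpoint (move f l) w := rfl

lemma endpoint_append (f : Pos) (u v : Word GenG) :
    endpoint f (u ++ v) = endpoint (endpoint f u) v := by
  simp [endpoint]

lemma weight_append (cx cy : Pos → ℤ) (f : Pos) (u v : Word GenG) :
    weight cx cy f (u ++ v) = weight cx cy f u + weight cx cy (endpoint f u) v := by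
  induction u generalizing f with
  | nil => simp [weight]
  | cons l u ih => simp [weight, ih, add_assoc]

lemma endpoint_replicate_x (f : Pos) (n : ℕ) :
    endpoint f (List.replicate n (GenG.x, true)) = f := by
  induction n with
  | zero => rfl
  | succ n ih => simpa [List.replicate_succ, move] using ih

lemma weight_replicate_x (cx cy : Pos → ℤ) (f : Pos) (n : ℕ) :
    weight cx cy f (List.replicate n (GenG.x, true)) = n * cx f := by
  induction n with
  | zero => simp [weight]
  | succ n ih =>
    simp only [List.replicate_succ, weight, contrib, move, ih]
    push_cast
    ring

/-! ### Letter counts -/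

def countXY (w : Word GenG) : ℕ := w.countP fun l => l.1 = GenG.x ∨ l.1 = GenG.y
def countS (w : Word GenG) : ℕ := w.countP fun l => l.1 = GenG.s
def countT (w : Word GenG) : ℕ := w.countP fun l => l.1 = GenG.t

lemma countXY_cons (l : GenG × Bool) (w : Word GenG) :
    countXY (l :: w) = countXY w + if l.1 = GenG.x ∨ l.1 = GenG.y then 1 else 0 := by
  simp [countXY, List.countP_cons]

lemma length_eq_counts (w : Word GenG) : w.length = countXY w + countS w + countT w := by
  induction w with
  | nil => rfl
  | cons l w ih =>
    obtain ⟨a, b⟩ := l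
    cases a <;> simp [countXY, countS, countT] at ih ⊢ <;> omega

/-- Distance to `0` in the 4-cycle. -/
def cycleNorm (a : ZMod 4) : ℕ := min a.val (4 - a.val)

lemma cycleNorm_le (f : Pos) (w : Word GenG) :
    cycleNorm ((endpoint f w).1 - f.1) ≤ countS w := by
  induction w generalizing f with
  | nil => simp [cycleNorm]
  | cons l w ih =>
    obtain ⟨⟨⟩, b⟩ := l
    case s =>
      have h := ih (move f (GenG.s, b))
      have key : ∀ a c : ZMod 4, (cycleNorm (a - c) ≤ cycleNorm (a - (c + 1)) + 1) ∧
          (cycleNorm (a - c) ≤ cycleNorm (a - (c + -1)) + 1) := by decide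
      have hk := key (endpoint f ((GenG.s, b) :: w)).1 f.1
      have hc : countS ((GenG.s, b) :: w) = countS w + 1 := by simp [countS]
      rw [hc]
      cases b
      · simp only [endpoint_cons, move, Prod.fst_add] at h hk ⊢
        omega
      · simp only [endpoint_cons, move, Prod.fst_add] at h hk ⊢
        omega
    case x => simpa [countS, move] using ih f
    case y => simpa [countS, move] using ih f
    case t => simpa [countS, move] using ih (move f (GenG.t, b))

/-! ### Words staying inside a set of positions -/

/-- Every letter of the word is read at a position in `S`, when starting at `f`. -/
def Within (S : Set Pos) : Pos → Word GenG → Prop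
  | _, [] => True
  | f, l :: w => f ∈ S ∧ Within S (move f l) w

lemma Within.inter {S T : Set Pos} {f : Pos} {w : Word GenG} (h₁ : Within S f w)
    (h₂ : Within T f w) : Within (S ∩ T) f w := by
  induction w generalizing f with
  | nil => trivial
  | cons l w ih => exact ⟨⟨h₁.1, h₂.1⟩, ih h₁.2 h₂.2⟩

lemma within_univ (f : Pos) (w : Word GenG) : Within Set.univ f w := by
  induction w generalizing f with
  | nil => trivial
  | cons l w ih => exact ⟨trivial, ih _⟩

lemma within_of_countT {f : Pos} {w : Word GenG} (hf : f.2 = 0) (hw : countT w = 0) :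
    Within {p | p.2 = 0} f w := by
  induction w generalizing f with
  | nil => trivial
  | cons l w ih =>
    obtain ⟨⟨⟩, b⟩ := l
    case t => simp [countT] at hw
    all_goals
      refine ⟨hf, ih ?_ (by simpa [countT] using hw)⟩
      cases b <;> simp [move, hf]

/-- Splitting a word at its first visit to `p`. -/
lemma within_or_visit (p f : Pos) (w : Word GenG) :
    Within {q | q ≠ p} f w ∨
      ∃ u v, w = u ++ v ∧ endpoint f u = p ∧ Within {q | q ≠ p} f u := by
  induction w generalizing f with
  | nil => exact Or.inl trivial
  | cons l w ih =>
    by_cases hf : f = p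
    · exact Or.inr ⟨[], l :: w, rfl, hf, trivial⟩
    · rcases ih (move f l) with h | ⟨u, v, rfl, hu, hw⟩
      · exact Or.inl ⟨hf, h⟩
      · exact Or.inr ⟨l :: u, v, rfl, hu, hf, hw⟩

lemma abs_weight_le {cx cy : Pos → ℤ} {S : Set Pos} {K : ℤ}
    (hx : ∀ f ∈ S, |cx f| ≤ K) (hy : ∀ f ∈ S, |cy f| ≤ K) {f : Pos} {w : Word GenG}
    (h : Within S f w) : |weight cx cy f w| ≤ K * countXY w := by
  induction w generalizing f with
  | nil => simp [weight, countXY]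
  | cons l w ih =>
    have h₁ := hx f h.1
    have h₂ := hy f h.1
    have h₃ := ih h.2
    rw [abs_le] at *
    rw [countXY_cons]
    obtain ⟨⟨⟩, ⟨⟩⟩ := l <;> simp [weight, contrib] <;> constructor <;> linarith

/-- If the weight reaches its maximum then every letter other than `s` is a positive `x`. -/
lemma weight_le_and_eq {cx cy : Pos → ℤ} {S : Set Pos}
    (hx : ∀ f ∈ S, 0 ≤ cx f ∧ cx f ≤ 1) (hy : ∀ f ∈ S, cy f = 0)
    {f : Pos} {w : Word GenG} (h : Within S f w) :
    weight cx cy f w ≤ countXY w ∧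
      (weight cx cy f w = countXY w →
        ∀ l ∈ w, l.1 = GenG.x ∨ l.1 = GenG.y → l = (GenG.x, true)) := by
  induction w generalizing f with
  | nil => simp [weight, countXY]
  | cons l w ih =>
    have h₁ := hx f h.1
    have h₂ := hy f h.1
    have h₃ := ih h.2
    simp only [List.mem_cons, forall_eq_or_imp]
    obtain ⟨⟨⟩, ⟨⟩⟩ := l <;> simp only [weight, contrib, countXY] at h₃ ⊢ <;> simp at h₃ ⊢ <;>
      grind

/-! ### Invariants of the evaluation -/

/-- The permutation of `Pos × ℤ` translating the fibres by `h`. -/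
def fibreShift (h : Pos → ℤ) : Equiv.Perm (Pos × ℤ) where
  toFun p := (p.1, p.2 + h p.1)
  invFun p := (p.1, p.2 - h p.1)
  left_inv p := by simp
  right_inv p := by simp

/-- The permutation of `Pos × ℤ` translating the base by `v`. -/
def baseShift (v : Pos) : Equiv.Perm (Pos × ℤ) where
  toFun p := (p.1 + v, p.2)
  invFun p := (p.1 - v, p.2)
  left_inv p := by simp
  right_inv p := by simp

open MulOpposite

/-- The images of the generators in the (opposite) permutation group of `Pos × ℤ`. -/
def genPerm (cx cy : Pos → ℤ) : GenG → (Equiv.Perm (Pos × ℤ))ᵐᵒᵖ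
  | GenG.x => op (fibreShift cx)
  | GenG.y => op (fibreShift cy)
  | GenG.s => op (baseShift (1, 0))
  | GenG.t => op (baseShift (0, 1))

lemma baseShift_mul (v w : Pos) : baseShift v * baseShift w = baseShift (v + w) := by
  ext p <;> simp [baseShift, add_comm v w, add_assoc]

lemma baseShift_zero : baseShift 0 = 1 := by
  ext p <;> simp [baseShift]

lemma baseShift_inv (v : Pos) : (baseShift v)⁻¹ = baseShift (-v) := by
  rw [inv_eq_iff_mul_eq_one, baseShift_mul, add_neg_cancel, baseShift_zero]

lemma fibreShift_mul (h k : Pos → ℤ) : fibreShift h * fibreShift k = fibreShift (h + k) := by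
  ext p <;> simp [fibreShift]
  ring

lemma fibreShift_conj (h : Pos → ℤ) (v : Pos) :
    baseShift v * fibreShift h * (baseShift v)⁻¹ = fibreShift fun f => h (f - v) := by
  rw [baseShift_inv]
  ext p <;> simp [fibreShift, baseShift, sub_eq_add_neg]

lemma lift_conjsG (cx cy : Pos → ℤ) {b : FG} (hb : b ∈ conjsG) :
    ∃ v, FreeGroup.lift (genPerm cx cy) b = op (baseShift v) := by
  have hs : FreeGroup.lift (genPerm cx cy) gs = op (baseShift (1, 0)) := by simp [gs, genPerm]
  have ht : FreeGroup.lift (genPerm cx cy) gt = op (baseShift (0, 1)) := by simp [gt, genPerm]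
  simp only [conjsG, List.mem_cons, List.not_mem_nil, or_false] at hb
  rcases hb with rfl | rfl | rfl | rfl | rfl | rfl | rfl | rfl <;>
    simp only [map_one, map_mul, hs, ht, pow_succ, pow_zero, one_mul, ← op_mul,
      baseShift_mul]
  · exact ⟨0, by rw [baseShift_zero, op_one]⟩
  all_goals exact ⟨_, rfl⟩

lemma lift_cnj (cx cy : Pos → ℤ) {a b : FG} {h : Pos → ℤ} {v : Pos}
    (ha : FreeGroup.lift (genPerm cx cy) a = op (fibreShift h))
    (hb : FreeGroup.lift (genPerm cx cy) b = op (baseShift v)) :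
    FreeGroup.lift (genPerm cx cy) (cnj a b) = op (fibreShift fun f => h (f - v)) := by
  rw [← fibreShift_conj]
  simp [cnj, ha, hb, mul_assoc]

lemma lift_basisG (cx cy : Pos → ℤ) {a : FG} (ha : a ∈ basisG) :
    ∃ h, FreeGroup.lift (genPerm cx cy) a = op (fibreShift h) := by
  simp only [basisG, List.mem_append, List.mem_map] at ha
  rcases ha with ⟨b, hb, rfl⟩ | ⟨b, hb, rfl⟩ <;> obtain ⟨v, hv⟩ := lift_conjsG cx cy hb
  · exact ⟨_, lift_cnj cx cy (h := cx) (by simp [gx, genPerm]) hv⟩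
  · exact ⟨_, lift_cnj cx cy (h := cy) (by simp [gy, genPerm]) hv⟩

lemma lift_relsG {cx cy : Pos → ℤ}
    (hc : ∀ f, cx f + cx (f + (2, 0)) = cy f + cy (f + (0, 1))) :
    ∀ r ∈ relsG, FreeGroup.lift (genPerm cx cy) r = 1 := by
  have hs : FreeGroup.lift (genPerm cx cy) gs = op (baseShift (1, 0)) := by simp [gs, genPerm]
  have ht : FreeGroup.lift (genPerm cx cy) gt = op (baseShift (0, 1)) := by simp [gt, genPerm]
  have hx : FreeGroup.lift (genPerm cx cy) gx = op (fibreShift cx) := by simp [gx, genPerm]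
  have hy : FreeGroup.lift (genPerm cx cy) gy = op (fibreShift cy) := by simp [gy, genPerm]
  have hs2 : FreeGroup.lift (genPerm cx cy) (gs ^ 2) = op (baseShift (2, 0)) := by
    rw [map_pow, hs, ← op_pow, pow_two, baseShift_mul]
    rfl
  rintro r ((hr | ⟨a, ha, b, hb, rfl⟩) | rfl)
  · rcases hr with rfl | rfl | rfl
    · rw [map_pow, ht, ← op_pow, pow_two, baseShift_mul, ← op_one, ← baseShift_zero]
      rfl
    · rw [map_pow, hs, ← op_pow, ← op_one, ← baseShift_zero]
      simp only [pow_succ, pow_zero, one_mul, baseShift_mul]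
      rfl
    · simp only [map_mul, map_inv, hs, ht, ← op_inv, ← op_mul, baseShift_inv, baseShift_mul]
      rw [← op_one, ← baseShift_zero]
      rfl
  · obtain ⟨h, hh⟩ := lift_basisG cx cy ha
    obtain ⟨k, hk⟩ := lift_basisG cx cy hb
    rw [← commutatorElement_def, map_commutatorElement, commutatorElement_eq_one_iff_mul_comm,
      hh, hk, ← op_mul, ← op_mul, fibreShift_mul, fibreShift_mul, add_comm]
  · rw [map_mul, map_inv, mul_inv_eq_one, map_mul, map_mul, hx, hy, lift_cnj cx cy hx hs2,
      lift_cnj cx cy hy ht, ← op_mul, ← op_mul, fibreShift_mul, fibreShift_mul]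
    congr 2
    funext f
    have h₂ : f - (2, 0) = f + (2, 0) := by revert f; decide
    have h₁ : f - (0, 1) = f + (0, 1) := by revert f; decide
    have := hc f
    simp only [Pi.add_apply, h₂, h₁]
    linarith

/-- The representation of `G` on `Pos × ℤ` attached to a pair of compatible weights. -/
def rep (cx cy : Pos → ℤ) (hc : ∀ f, cx f + cx (f + (2, 0)) = cy f + cy (f + (0, 1))) :
    G →* (Equiv.Perm (Pos × ℤ))ᵐᵒᵖ :=
  PresentedGroup.toGroup (lift_relsG hc)

lemma evalG_cons (l : GenG × Bool) (w : Word GenG) :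
    evalG (l :: w) = evalG [l] * evalG w := by
  simp [evalG, evalWith]

lemma evalG_append (u v : Word GenG) : evalG (u ++ v) = evalG u * evalG v := by
  simp [evalG, evalWith]

lemma evalG_replicate (n : ℕ) (l : GenG × Bool) :
    evalG (List.replicate n l) = evalG [l] ^ n := by
  simp [evalG, evalWith]

lemma rep_evalG {cx cy : Pos → ℤ} (hc : ∀ f, cx f + cx (f + (2, 0)) = cy f + cy (f + (0, 1)))
    (w : Word GenG) (f : Pos) (z : ℤ) :
    unop (rep cx cy hc (evalG w)) (f, z) = (endpoint f w, z + weight cx cy f w) := by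
  induction w generalizing f z with
  | nil => simp [evalG, evalWith, weight]
  | cons l w ih =>
    have hl : unop (rep cx cy hc (evalG [l])) (f, z) = (move f l, z + contrib cx cy f l) := by
      have ht : ∀ f : Pos, f - (0, 1) = f + (0, 1) := by decide
      obtain ⟨⟨⟩, ⟨⟩⟩ := l <;>
        simp [evalG, evalWith, rep, PresentedGroup.toGroup.of, genPerm, move, contrib] <;>
        simp [fibreShift, baseShift, Equiv.symm, ht, sub_eq_add_neg]
    rw [evalG_cons, map_mul, unop_mul, Equiv.Perm.mul_apply, hl, ih]
    simp [weight, add_assoc]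

lemma endpoint_eq_of_evalG_eq {u v : Word GenG} (h : evalG u = evalG v) (f : Pos) :
    endpoint f u = endpoint f v := by
  have hu := rep_evalG (cx := 0) (cy := 0) (by simp) u f 0
  rw [h, rep_evalG] at hu
  exact (congrArg Prod.fst hu).symm

lemma weight_eq_of_evalG_eq {cx cy : Pos → ℤ}
    (hc : ∀ f, cx f + cx (f + (2, 0)) = cy f + cy (f + (0, 1))) {u v : Word GenG}
    (h : evalG u = evalG v) (f : Pos) : weight cx cy f u = weight cx cy f v := by
  have hu := rep_evalG hc u f 0
  rw [h, rep_evalG] at hu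
  simpa using (congrArg Prod.snd hu).symm

/-! ### Identities in `G` -/

lemma mk_rel {r : FG} (hr : r ∈ relsG) : PresentedGroup.mk relsG r = 1 :=
  (PresentedGroup.mk_eq_one_iff).2 (Subgroup.subset_normalClosure hr)

lemma Gt_sq : Gt ^ 2 = 1 :=
  mk_rel (r := gt ^ 2) (by simp [relsG])

lemma Gs_pow_four : Gs ^ 4 = 1 :=
  mk_rel (r := gs ^ 4) (by simp [relsG])

lemma Gs_comm_Gt : Gs * Gt = Gt * Gs := by
  have h : Gs⁻¹ * Gt⁻¹ * Gs * Gt = 1 := by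
    simpa [gs, gt, Gs, Gt, PresentedGroup.of] using
      mk_rel (r := gs⁻¹ * gt⁻¹ * gs * gt) (by simp [relsG])
  have h' : (Gt * Gs)⁻¹ * (Gs * Gt) = 1 := by rw [← h]; group
  exact (inv_mul_eq_one.1 h').symm

lemma Gx_mul_conj : Gx * (Gs ^ 2 * Gx * (Gs ^ 2)⁻¹) = Gy * (Gt * Gy * Gt⁻¹) := by
  have h : Gx * cnj Gx (Gs ^ 2) * (Gy * cnj Gy Gt)⁻¹ = 1 := by
    have := mk_rel (r := gx * cnj gx (gs ^ 2) * (gy * cnj gy gt)⁻¹) (by simp [relsG])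
    simp only [cnj, map_mul, map_inv, map_pow] at this
    exact this
  have hs : (Gs ^ 2)⁻¹ = Gs ^ 2 := inv_eq_of_mul_eq_one_left (by rw [← pow_add]; exact Gs_pow_four)
  have ht : Gt⁻¹ = Gt := inv_eq_of_mul_eq_one_left (by rw [← pow_two]; exact Gt_sq)
  rw [mul_inv_eq_one] at h
  simpa [cnj, hs, ht] using h

lemma commute_basisG {a b : FG} (ha : a ∈ basisG) (hb : b ∈ basisG) :
    Commute (PresentedGroup.mk relsG a) (PresentedGroup.mk relsG b) := by
  have h := mk_rel (r := a * b * a⁻¹ * b⁻¹) (Or.inl (Or.inr ⟨a, ha, b, hb, rfl⟩))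
  rw [← commutatorElement_def, map_commutatorElement] at h
  exact commutatorElement_eq_one_iff_commute.1 h

/-- The element of `⟨s, t⟩` representing a position. -/
def posElt (f : Pos) : G := Gs ^ f.1.val * Gt ^ f.2.val

lemma posElt_add (f g : Pos) : posElt (f + g) = posElt f * posElt g := by
  have hs : Gs ^ (f + g).1.val = Gs ^ f.1.val * Gs ^ g.1.val := by
    rw [← pow_add, Prod.fst_add, ZMod.val_add, ← pow_eq_pow_mod _ Gs_pow_four]
  have ht : Gt ^ (f + g).2.val = Gt ^ f.2.val * Gt ^ g.2.val := by
    rw [← pow_add, Prod.snd_add, ZMod.val_add, ← pow_eq_pow_mod _ Gt_sq]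
  have hc : Commute (Gt ^ f.2.val) (Gs ^ g.1.val) :=
    (show Commute Gt Gs from Gs_comm_Gt.symm).pow_pow _ _
  rw [posElt, posElt, posElt, hs, ht, mul_assoc, mul_assoc, ← mul_assoc _ _ (Gt ^ g.2.val),
    hc.symm.eq, mul_assoc]

lemma posElt_zero : posElt 0 = 1 := by simp [posElt]

lemma posElt_neg (f : Pos) : posElt (-f) = (posElt f)⁻¹ := by
  rw [eq_inv_iff_mul_eq_one, ← posElt_add, neg_add_cancel, posElt_zero]

lemma exists_conjsG (f : Pos) : ∃ b ∈ conjsG, PresentedGroup.mk relsG b = posElt f := by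
  have hs : PresentedGroup.mk relsG gs = Gs := rfl
  have ht : PresentedGroup.mk relsG gt = Gt := rfl
  obtain ⟨a, c⟩ := f
  have ha : a.val < 4 := a.val_lt
  have hc : c.val < 2 := c.val_lt
  have hmem : gt ^ c.val * gs ^ a.val ∈ conjsG := by
    interval_cases a.val <;> interval_cases c.val <;> simp [conjsG]
  refine ⟨_, hmem, ?_⟩
  simp only [map_mul, map_pow, hs, ht, posElt]
  exact ((show Commute Gt Gs from Gs_comm_Gt.symm).pow_pow _ _).eq

/-- The conjugate of `x` sitting at position `f`. -/
def xAt (f : Pos) : G := posElt f * Gx * (posElt f)⁻¹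

lemma xAt_eq_mk (f : Pos) : ∃ a ∈ basisG, PresentedGroup.mk relsG a = xAt f := by
  obtain ⟨b, hb, hbf⟩ := exists_conjsG (-f)
  refine ⟨cnj gx b, by simp only [basisG, List.mem_append, List.mem_map]; exact Or.inl ⟨b, hb, rfl⟩,
    ?_⟩
  have hx : PresentedGroup.mk relsG gx = Gx := rfl
  simp only [cnj, map_mul, map_inv, hbf, hx, posElt_neg, inv_inv, xAt]

lemma commute_Gx_xAt (f : Pos) : Commute Gx (xAt f) := by
  obtain ⟨a, ha, haf⟩ := xAt_eq_mk f
  rw [← haf]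
  exact commute_basisG (a := gx) (by simp [basisG, conjsG, cnj]) ha

lemma commute_Gy_xAt (f : Pos) : Commute Gy (xAt f) := by
  obtain ⟨a, ha, haf⟩ := xAt_eq_mk f
  rw [← haf]
  exact commute_basisG (a := gy) (by simp [basisG, conjsG, cnj]) ha

lemma xAt_add (f g : Pos) : posElt g * xAt f = xAt (f + g) * posElt g := by
  rw [xAt, xAt, add_comm, posElt_add]
  group

lemma evalG_letter_mul_xAt (l : GenG × Bool) (f : Pos) :
    evalG [l] * xAt f = xAt (move f l) * evalG [l] := by
  have hs : Gs = posElt (1, 0) := by simp [posElt, show (1 : ZMod 4).val = 1 from rfl]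
  have ht : Gt = posElt (0, 1) := by simp [posElt, show (1 : ZMod 2).val = 1 from rfl]
  have ht' : Gt⁻¹ = Gt := inv_eq_of_mul_eq_one_left (by rw [← pow_two]; exact Gt_sq)
  obtain ⟨⟨⟩, ⟨⟩⟩ := l <;> simp only [evalG, evalWith, move, List.map_cons, List.map_nil,
    List.prod_cons, List.prod_nil, mul_one, if_true, Bool.false_eq_true, if_false]
  · exact (commute_Gx_xAt f).inv_left.eq
  · exact (commute_Gx_xAt f).eq
  · exact (commute_Gy_xAt f).inv_left.eq
  · exact (commute_Gy_xAt f).eq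
  · change Gs⁻¹ * _ = _ * Gs⁻¹
    rw [hs, ← posElt_neg, xAt_add]
    rfl
  · change Gs * _ = _ * Gs
    rw [hs, xAt_add]
  · change Gt⁻¹ * _ = _ * Gt⁻¹
    rw [ht', ht, xAt_add]
  · change Gt * _ = _ * Gt
    rw [ht, xAt_add]

lemma move_endpoint (f : Pos) (l : GenG × Bool) (w : Word GenG) :
    endpoint (move f l) w = move (endpoint f w) l := by
  induction w generalizing f with
  | nil => rfl
  | cons k w ih =>
    have hcomm : move (move f l) k = move (move f k) l := by
      obtain ⟨⟨⟩, ⟨⟩⟩ := l <;> obtain ⟨⟨⟩, ⟨⟩⟩ := k <;> simp only [move] <;> abel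
    simp only [endpoint_cons, hcomm, ih]

lemma evalG_mul_xAt (w : Word GenG) (f : Pos) :
    evalG w * xAt f = xAt (endpoint f w) * evalG w := by
  induction w with
  | nil => simp [evalG, evalWith]
  | cons l w ih =>
    rw [evalG_cons, mul_assoc, ih, ← mul_assoc, evalG_letter_mul_xAt, endpoint_cons,
      move_endpoint, mul_assoc]

/-- Words evaluating to `xⁿ (s² x s⁻²)ᵐ`. -/
def refWord (n m : ℕ) : Word GenG :=
  List.replicate n (GenG.x, true) ++ ([(GenG.s, true), (GenG.s, true)] ++
    (List.replicate m (GenG.x, true) ++ [(GenG.s, false), (GenG.s, false)]))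

lemma length_refWord (n m : ℕ) : (refWord n m).length = n + m + 4 := by
  simp [refWord]
  omega

lemma endpoint_refWord (n m : ℕ) : endpoint 0 (refWord n m) = 0 := by
  simp only [refWord, endpoint_append, endpoint_replicate_x]
  decide

lemma weight_refWord (cx cy : Pos → ℤ) (n m : ℕ) :
    weight cx cy 0 (refWord n m) = n * cx 0 + m * cx (2, 0) := by
  simp only [refWord, weight_append, endpoint_replicate_x, weight_replicate_x]
  have h : endpoint 0 [(GenG.s, true), (GenG.s, true)] = (2, 0) := by decide
  rw [h]
  simp [weight, contrib]

lemma evalG_x : evalG [(GenG.x, true)] = Gx := by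
  simp [evalG, evalWith, Gx]

lemma xAt_zero : xAt 0 = Gx := by simp [xAt, posElt_zero]

lemma xAt_two : xAt (2, 0) = Gs ^ 2 * Gx * (Gs ^ 2)⁻¹ := by
  simp [xAt, posElt, show (2 : ZMod 4).val = 2 from rfl]

lemma evalG_mul_pow (u : Word GenG) (k : ℕ) :
    evalG u * Gx ^ k = xAt (endpoint 0 u) ^ k * evalG u := by
  have h : SemiconjBy (evalG u) Gx (xAt (endpoint 0 u)) := by
    have := evalG_mul_xAt u 0
    rwa [xAt_zero] at this
  exact (h.pow_right k).eq

lemma evalG_refWord (n m : ℕ) : evalG (refWord n m) = Gx ^ n * xAt (2, 0) ^ m := by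
  have h : (evalG [(GenG.s, true), (GenG.s, true)] : G) = Gs ^ 2 := by
    simp [evalG, evalWith, Gs, pow_two]
  have h' : (evalG [(GenG.s, false), (GenG.s, false)] : G) = (Gs ^ 2)⁻¹ := by
    simp [evalG, evalWith, Gs, pow_two]
  rw [refWord, evalG_append, evalG_append, evalG_append, evalG_replicate, evalG_replicate,
    evalG_x, h, h', xAt_two, conj_pow, mul_assoc]

lemma evalG_shortcut {n k : ℕ} (h : k ≤ n) :
    evalG (List.replicate (n - k) (GenG.x, true) ++ (List.replicate k (GenG.y, true) ++
      ([(GenG.t, true)] ++ (List.replicate k (GenG.y, true) ++ [(GenG.t, false)])))) =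
      Gx ^ n * xAt (2, 0) ^ k := by
  have hy : evalG [(GenG.y, true)] = Gy := by simp [evalG, evalWith, Gy]
  have ht : evalG [(GenG.t, true)] = Gt := by simp [evalG, evalWith, Gt]
  have ht' : evalG [(GenG.t, false)] = Gt⁻¹ := by simp [evalG, evalWith, Gt]
  have hcomm : Commute Gy (Gt * Gy * Gt⁻¹) := by
    have h₁ : Gt * Gy * Gt⁻¹ = Gy⁻¹ * (Gx * xAt (2, 0)) := by
      rw [xAt_two, Gx_mul_conj]
      group
    have h₂ : Commute Gy Gx := xAt_zero ▸ commute_Gy_xAt 0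
    rw [h₁]
    exact (Commute.refl Gy).inv_right.mul_right (h₂.mul_right (commute_Gy_xAt _))
  have hpow : Gx ^ n = Gx ^ (n - k) * Gx ^ k := by rw [← pow_add, Nat.sub_add_cancel h]
  simp only [evalG_append, evalG_replicate, evalG_x, hy, ht, ht']
  rw [hpow, mul_assoc, ← (commute_Gx_xAt (2, 0)).mul_pow, xAt_two, Gx_mul_conj, hcomm.mul_pow,
    conj_pow]
  simp only [mul_assoc]

lemma IsGeodesicG.length_le {u v : Word GenG} (hu : IsGeodesicG u) (h : evalG v = evalG u) :
    u.length ≤ v.length := by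
  rw [hu]
  exact Nat.sInf_le ⟨v, h, rfl⟩

lemma countS_append (u v : Word GenG) : countS (u ++ v) = countS u + countS v := by
  simp [countS]

lemma countT_append (u v : Word GenG) : countT (u ++ v) = countT u + countT v := by
  simp [countT]

/-- A word of minimal length for `xⁿ (s² x s⁻²)ⁿ⁺³` contains all the conjugated letters `x`
in one block. -/
lemma exists_block {n : ℕ} {w : Word GenG} (hlen : w.length ≤ 2 * n + 7)
    (hw : evalG w = evalG (refWord n (n + 3))) :
    2 * n + 7 ≤ w.length ∧ ∃ u v, w = u ++ (List.replicate (n + 3) (GenG.x, true) ++ v) ∧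
      endpoint 0 u = (2, 0) := by
  have hend : endpoint 0 w = 0 := by rw [endpoint_eq_of_evalG_eq hw, endpoint_refWord]
  have hcounts := length_eq_counts w
  have hwt : ∀ cx cy : Pos → ℤ, (∀ f, cx f + cx (f + (2, 0)) = cy f + cy (f + (0, 1))) →
      weight cx cy 0 w = n * cx 0 + (n + 3) * cx (2, 0) := fun cx cy hc => by
    rw [weight_eq_of_evalG_eq hc hw, weight_refWord]
    push_cast
    rfl
  have hXY : 2 * n + 3 ≤ countXY w := by
    have h := hwt (fun _ => 1) (fun _ => 1) (by simp)
    have h' := abs_weight_le (cx := fun _ => 1) (cy := fun _ => 1) (K := 1) (by simp) (by simp)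
      (within_univ 0 w)
    have := (abs_le.1 h').2
    rw [h] at this
    omega
  obtain ⟨u, v, rfl, hu, huw⟩ : ∃ u v, w = u ++ v ∧ endpoint 0 u = (2, 0) ∧
      Within {q | q ≠ (2, 0)} 0 u := by
    refine (within_or_visit (2, 0) 0 w).resolve_left fun hin => ?_
    have h := hwt (fun f => if f = 0 then -1 else if f = (2, 0) then 3 else 1) (fun _ => 1)
      (by decide)
    have h' := abs_weight_le (cx := fun f => if f = 0 then -1 else if f = (2, 0) then 3 else 1)
      (cy := fun _ => 1) (K := 1) (by
        intro f (hf : f ≠ (2, 0))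
        simp only [hf, if_false]
        split_ifs <;> simp) (by simp) hin
    have := (abs_le.1 h').2
    rw [h] at this
    simp [show (2 : ZMod 4) ≠ 0 by decide] at this
    omega
  have huS : 2 ≤ countS u := by
    have := cycleNorm_le 0 u
    rw [hu] at this
    exact this
  have hvend : endpoint (2, 0) v = 0 := by rw [← hu, ← endpoint_append, hend]
  have hvS : 2 ≤ countS v := by
    have := cycleNorm_le (2, 0) v
    rw [hvend] at this
    exact this
  rw [countS_append] at hcounts
  have hT : countT (u ++ v) = 0 := by omega
  have hT' := hT
  rw [countT_append] at hT'
  refine ⟨by omega, ?_⟩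
  have hpos : ∀ l ∈ u ++ v, l.1 = GenG.x ∨ l.1 = GenG.y → l = (GenG.x, true) := by
    refine (weight_le_and_eq (cx := fun f => if f.1 = 0 ∨ f.1 = 2 then 1 else 0)
      (cy := fun f => if f.2 = 1 ∧ (f.1 = 0 ∨ f.1 = 2) then 2 else 0) ?_ ?_
      (within_of_countT (f := 0) rfl hT)).2 ?_
    · intro f _
      split_ifs <;> simp
    · intro f (hf : f.2 = 0)
      simp [hf]
    · rw [hwt _ _ (by decide)]
      simp
      omega
  obtain ⟨C, D, rfl, hC, hD⟩ : ∃ C D : Word GenG, v = C ++ D ∧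
      (∀ l ∈ C, l = (GenG.x, true)) ∧ ∀ l ∈ D.head?, l.1 = GenG.s := by
    refine ⟨v.takeWhile (fun l => l = (GenG.x, true)), v.dropWhile (fun l => l = (GenG.x, true)),
      (List.takeWhile_append_dropWhile).symm, fun l hl => ?_, fun l hl => ?_⟩
    · simpa using List.mem_takeWhile_imp hl
    · have hne := List.head?_dropWhile_not (fun l => decide (l = (GenG.x, true))) v
      rw [Option.mem_def] at hl
      rw [hl] at hne
      have hmem : l ∈ v := (List.dropWhile_sublist _).mem (List.mem_of_mem_head? hl)
      have hne' : l ≠ (GenG.x, true) := by simpa using hne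
      have h₁ := mt (hpos l (List.mem_append_right u hmem)) hne'
      have h₂ : l.1 ≠ GenG.t := by
        intro ht
        have := List.countP_eq_zero.1 hT l (List.mem_append_right u hmem)
        simp [ht] at this
      rcases l with ⟨⟨⟩, b⟩ <;> simp_all
  obtain ⟨q, rfl⟩ : ∃ q, C = List.replicate q (GenG.x, true) := ⟨_, List.eq_replicate_of_mem hC⟩
  have hcS : countS (List.replicate q (GenG.x, true)) = 0 := by
    simp [countS, List.countP_replicate]
  rw [countS_append, hcS] at hcounts hvS
  rw [endpoint_append, endpoint_replicate_x] at hvend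
  cases D with
  | nil => simp [countS] at hvS
  | cons l D =>
    have hl : l.1 = GenG.s := hD l rfl
    have hlS : countS (l :: D) = countS D + 1 := by simp [countS, hl]
    rw [countT_append] at hT'
    have hDT : countT D = 0 := by
      have : countT (l :: D) = countT D := by simp [countT, hl]
      omega
    have hl2 : (move (2, 0) l).2 = 0 := by
      obtain ⟨a, b⟩ := l
      obtain rfl : a = GenG.s := hl
      cases b <;> rfl
    have hDw : Within {p | p ≠ (2, 0)} (move (2, 0) l) D := by
      refine (within_or_visit (2, 0) _ D).resolve_right ?_
      rintro ⟨D₁, D₂, rfl, hD₁, -⟩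
      have h := cycleNorm_le (2, 0) D₂
      rw [← hD₁, ← endpoint_append, ← endpoint_cons, hvend, hD₁] at h
      have h2 : 2 ≤ countS D₂ := h
      rw [countS_append] at hlS
      omega
    have key := hwt (fun f => if f.1 = 2 then 1 else 0)
      (fun f => if f.2 = 1 ∧ (f.1 = 0 ∨ f.1 = 2) then 1 else 0) (by decide)
    have hzero : ∀ (f : Pos) (z : Word GenG), f.2 = 0 → countT z = 0 →
        Within {p | p ≠ (2, 0)} f z → weight (fun f => if f.1 = 2 then 1 else 0)
          (fun f => if f.2 = 1 ∧ (f.1 = 0 ∨ f.1 = 2) then 1 else 0) f z = 0 := by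
      intro f z hf hz hin
      have h := abs_weight_le (cx := fun f => if f.1 = 2 then 1 else 0)
        (cy := fun f => if f.2 = 1 ∧ (f.1 = 0 ∨ f.1 = 2) then 1 else 0) (K := 0)
        (by
          rintro ⟨a, b⟩ ⟨h₁, h₂⟩
          have : a ≠ 2 := fun ha => h₁ (by rw [ha, show b = 0 from h₂])
          simp [this])
        (by
          rintro f ⟨-, h₂⟩
          simp [show f.2 = 0 from h₂]) (hin.inter (within_of_countT hf hz))
      simpa using h
    rw [weight_append, weight_append, hu, endpoint_replicate_x, weight_replicate_x, weight,
      hzero _ _ rfl (by omega) huw, hzero _ _ hl2 hDT hDw] at key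
    have hlc : contrib (fun f => if f.1 = 2 then 1 else 0)
        (fun f => if f.2 = 1 ∧ (f.1 = 0 ∨ f.1 = 2) then 1 else 0) (2, 0) l = 0 := by
      obtain ⟨a, b⟩ := l
      obtain rfl : a = GenG.s := hl
      cases b <;> rfl
    rw [hlc] at key
    have hq : q = n + 3 := by
      have h0 : (0 : ZMod 4) ≠ 2 := by decide
      simp [h0] at key
      omega
    exact ⟨u, l :: D, by rw [hq], hu⟩

/-- Runs on a repeated letter can be shortened to at most the number of states. -/
lemma exists_short_run {α σ : Type*} [Fintype σ] (M : DFA α σ) (s : σ) (a : α) (q : ℕ) :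
    ∃ k ≤ Fintype.card σ,
      M.evalFrom s (List.replicate k a) = M.evalFrom s (List.replicate q a) := by
  induction q using Nat.strong_induction_on with
  | _ q ih =>
    by_cases hq : q ≤ Fintype.card σ
    · exact ⟨q, hq, rfl⟩
    obtain ⟨i, j, hij, h⟩ := Fintype.exists_ne_map_eq_of_card_lt
      (fun k : Fin (Fintype.card σ + 1) => M.evalFrom s (List.replicate k a)) (by simp)
    wlog hlt : i < j generalizing i j
    · exact this j i hij.symm h.symm (lt_of_le_of_ne (not_lt.1 hlt) hij.symm)
    have hj : (j : ℕ) ≤ q := by omega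
    have hlt' : (i : ℕ) < j := hlt
    obtain ⟨k, hk, hkq⟩ := ih (i + (q - j)) (by omega)
    refine ⟨k, hk, hkq.trans ?_⟩
    rw [List.replicate_add, DFA.evalFrom_of_append]
    rw [h, ← DFA.evalFrom_of_append, ← List.replicate_add, Nat.add_sub_cancel' hj]

end NS

open NS in
/-- For every regular language `L` over `X = {x^{±1}, y^{±1}, t^{±1}, s^{±1}}` all of whose
words are geodesic for `G`, the image of `L` under evaluation does not contain the
subgroup of `G` generated by `x`, `y`, `t` and `s²`. -/
theorem regular_geodesic_language_misses_subgroup :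
    ∀ L : Language (GenG × Bool), L.IsRegular → (∀ w ∈ L, IsGeodesicG w) →
      ¬ (∀ g : G, g ∈ Subgroup.closure {Gx, Gy, Gt, Gs ^ 2} → ∃ w ∈ L, evalG w = g) := by
  rintro L ⟨σ, hσ, M, rfl⟩ hgeo hcover
  set n := Fintype.card σ
  have hmem : evalG (refWord n (n + 3)) ∈ Subgroup.closure {Gx, Gy, Gt, Gs ^ 2} := by
    have hx : Gx ∈ Subgroup.closure {Gx, Gy, Gt, Gs ^ 2} := Subgroup.subset_closure (by simp)
    have hs : Gs ^ 2 ∈ Subgroup.closure {Gx, Gy, Gt, Gs ^ 2} := Subgroup.subset_closure (by simp)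
    rw [evalG_refWord, xAt_two]
    exact mul_mem (pow_mem hx _) (pow_mem (mul_mem (mul_mem hs hx) (inv_mem hs)) _)
  obtain ⟨w, hwL, hw⟩ := hcover _ hmem
  have hle := (hgeo w hwL).length_le hw.symm
  rw [length_refWord] at hle
  obtain ⟨hlen, u, v, rfl, hu⟩ := exists_block (by omega) hw
  obtain ⟨k, hk, hrun⟩ := exists_short_run M (M.eval u) (GenG.x, true) (n + 3)
  have hkL : u ++ (List.replicate k (GenG.x, true) ++ v) ∈ M.accepts := by
    rw [DFA.mem_accepts, DFA.eval, DFA.evalFrom_of_append, DFA.evalFrom_of_append] at hwL ⊢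
    change M.evalFrom (M.evalFrom (M.eval u) _) v ∈ M.accept
    rw [hrun]
    exact hwL
  have hblock : ∀ j, evalG (u ++ (List.replicate j (GenG.x, true) ++ v)) =
      xAt (2, 0) ^ j * (evalG u * evalG v) := fun j => by
    rw [evalG_append, evalG_append, evalG_replicate, evalG_x, ← mul_assoc, evalG_mul_pow, hu,
      mul_assoc]
  have hcomm : ∀ j, Gx ^ n * xAt (2, 0) ^ j = xAt (2, 0) ^ j * Gx ^ n := fun j =>
    ((commute_Gx_xAt (2, 0)).pow_pow n j).eq
  rw [hblock, evalG_refWord, hcomm, mul_right_inj] at hw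
  have hshort := (hgeo _ hkL).length_le ((evalG_shortcut hk).trans (by rw [hblock, hw, hcomm]))
  simp at hlen hshort
  omega
end

section
/- Let V be the Klein four-group and let H → V be the surjective homomorphism sending x and y to the identity and sending t and τ to the two generators of V. Then the kernel N of this homomorphism is a free abelian group of rank 5; in particular there is a short exact sequence 1 → ℤ⁵ → H → V → 1. -/
namespace NS

/-- The Klein four-group. -/
abbrev V := Multiplicative (ZMod 2 × ZMod 2)

/-- The first generator of the Klein four-group (image of `t`). -/
def vt : V := Multiplicative.ofAdd (1, 0)

/-- The second generator of the Klein four-group (image of `τ`). -/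
def vtau : V := Multiplicative.ofAdd (0, 1)

end NS

namespace NS

section Conjugation

variable {Γ Δ : Type*} [Group Γ] [Group Δ]

lemma cnj_one (a : Γ) : cnj a 1 = a := by simp [cnj]

lemma cnj_cnj (a b c : Γ) : cnj (cnj a b) c = cnj a (b * c) := by simp [cnj, mul_assoc]

lemma mul_cnj (a b c : Γ) : cnj (a * b) c = cnj a c * cnj b c := by simp [cnj, mul_assoc]

lemma map_cnj (f : Γ →* Δ) (a b : Γ) : f (cnj a b) = cnj (f a) (f b) := by simp [cnj]

/-- A family of pairwise commuting involutions `p`, `q` defines a homomorphism from `V`. -/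
def kleinLift (p q : Γ) (hp : p ^ 2 = 1) (hq : q ^ 2 = 1) (hpq : Commute p q) : V →* Γ :=
  MonoidHom.mk' (fun v => p ^ v.toAdd.1.val * q ^ v.toAdd.2.val) fun v w => by
    have key (r : Γ) (hr : r ^ 2 = 1) (i j : ZMod 2) :
        r ^ (i + j).val = r ^ i.val * r ^ j.val := by
      rw [ZMod.val_add, ← pow_eq_pow_mod _ hr, pow_add]
    simp only [toAdd_mul, Prod.fst_add, Prod.snd_add, key p hp, key q hq]
    exact (hpq.pow_pow _ _).mul_mul_mul_comm _ _

end Conjugation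

section CommutingFamily

variable {A : Type*} [CommGroup A] {ι : Type*} [Fintype ι]

/-- The homomorphism from a free abelian group sending the basis to the family `g`. -/
def zpowProdHom (g : ι → A) : Multiplicative (ι → ℤ) →* A :=
  MonoidHom.mk' (fun m => ∏ i, g i ^ m.toAdd i) fun m n => by
    simp [zpow_add, Finset.prod_mul_distrib]

lemma zpowProdHom_ofAdd_single [DecidableEq ι] (g : ι → A) (i : ι) :
    zpowProdHom g (Multiplicative.ofAdd (Pi.single i 1)) = g i := by
  simp only [zpowProdHom, MonoidHom.mk'_apply, toAdd_ofAdd]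
  rw [Finset.prod_eq_single i] <;> simp +contextual

lemma mem_range_zpowProdHom (g : ι → A) (i : ι) : g i ∈ (zpowProdHom g).range := by
  classical exact ⟨_, zpowProdHom_ofAdd_single g i⟩

end CommutingFamily

/-! ### The projection onto the Klein four-group -/

/-- Images of the generators of `H` in `V`. -/
def genToV : GenH → V
  | .x => 1
  | .y => 1
  | .t => vt
  | .tau => vtau

/-- The projection `H → V`. -/
def toV : H →* V := PresentedGroup.toGroup (f := genToV) <| by
  rintro r ((h | ⟨a, -, b, -, rfl⟩) | rfl)
  · rcases h with rfl | rfl | rfl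
    · simp only [ft, map_pow, FreeGroup.lift_apply_of]; decide
    · simp only [ftau, map_pow, FreeGroup.lift_apply_of]; decide
    · simp [mul_comm]
  · simp
  · simp [fx, fy, cnj, genToV]

/-! ### The affine action on `ℤ⁵`

The coordinates correspond to `x`, `x^t`, `y`, `y^τ` and `x * x^τ`. -/

/-- The linear involution by which `t` acts. -/
def actT (v : Fin 5 → ℤ) : Fin 5 → ℤ := ![v 1, v 0, -v 2, -v 3, v 4 + v 2 + v 3]

/-- The linear involution by which `τ` acts. -/
def actTau (v : Fin 5 → ℤ) : Fin 5 → ℤ := ![-v 0, -v 1, v 3, v 2, v 4 + v 0 + v 1]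

lemma actT_involutive : Function.Involutive actT := fun v => by
  ext i; fin_cases i <;> simp [actT]; ring

lemma actTau_involutive : Function.Involutive actTau := fun v => by
  ext i; fin_cases i <;> simp [actTau]; ring

lemma actT_add (u v : Fin 5 → ℤ) : actT (u + v) = actT u + actT v := by
  ext i; fin_cases i <;> simp [actT] <;> ring

lemma actTau_add (u v : Fin 5 → ℤ) : actTau (u + v) = actTau u + actTau v := by
  ext i; fin_cases i <;> simp [actTau] <;> ring

lemma addRight_mul_addRight {M : Type*} [AddCommGroup M] (u v : M) :
    Equiv.addRight u * Equiv.addRight v = Equiv.addRight (u + v) := by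
  ext1 w
  simp [add_assoc, add_comm u v]

lemma addRight_zpow {M : Type*} [AddCommGroup M] (u : M) (n : ℤ) :
    Equiv.addRight u ^ n = Equiv.addRight (n • u) := by
  let f : Multiplicative M →* Equiv.Perm M :=
    MonoidHom.mk' (fun u => Equiv.addRight u.toAdd) fun u v =>
      (addRight_mul_addRight u.toAdd v.toAdd).symm
  exact (map_zpow f (Multiplicative.ofAdd u) n).symm

lemma cnj_addRight_toPerm {M : Type*} [AddCommGroup M] {f : M → M} (hf : Function.Involutive f)
    (hadd : ∀ u v, f (u + v) = f u + f v) (u : M) :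
    cnj (Equiv.addRight u) (hf.toPerm f) = Equiv.addRight (f u) := by
  ext v
  change f (f v + u) = v + f u
  rw [hadd, hf]

/-- Images of the generators of `H` under the affine action. -/
def genToPerm : GenH → Equiv.Perm (Fin 5 → ℤ)
  | .x => Equiv.addRight ![1, 0, 0, 0, 0]
  | .y => Equiv.addRight ![0, 0, 1, 0, 0]
  | .t => actT_involutive.toPerm
  | .tau => actTau_involutive.toPerm

lemma cnj_addRight_genToPerm_t (u : Fin 5 → ℤ) :
    cnj (Equiv.addRight u) (genToPerm .t) = Equiv.addRight (actT u) :=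
  cnj_addRight_toPerm actT_involutive actT_add u

lemma cnj_addRight_genToPerm_tau (u : Fin 5 → ℤ) :
    cnj (Equiv.addRight u) (genToPerm .tau) = Equiv.addRight (actTau u) :=
  cnj_addRight_toPerm actTau_involutive actTau_add u

lemma genToPerm_t_mul_self : genToPerm .t * genToPerm .t = 1 := by
  ext1 v; exact actT_involutive v

lemma genToPerm_tau_mul_self : genToPerm .tau * genToPerm .tau = 1 := by
  ext1 v; exact actTau_involutive v

lemma genToPerm_t_mul_tau :
    genToPerm .t * genToPerm .tau = genToPerm .tau * genToPerm .t := by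
  ext1 v
  change actT (actTau v) = actTau (actT v)
  ext i; fin_cases i <;> simp [actT, actTau]; ring

lemma exists_lift_genToPerm_eq_addRight {a : FH} (ha : a ∈ basisH) :
    ∃ u, FreeGroup.lift genToPerm a = Equiv.addRight u := by
  have hx : FreeGroup.lift genToPerm fx = Equiv.addRight ![1, 0, 0, 0, 0] := by
    simp [fx, genToPerm]
  have hy : FreeGroup.lift genToPerm fy = Equiv.addRight ![0, 0, 1, 0, 0] := by
    simp [fy, genToPerm]
  have ht : FreeGroup.lift genToPerm ft = genToPerm .t := by simp [ft]
  have htau : FreeGroup.lift genToPerm ftau = genToPerm .tau := by simp [ftau]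
  simp only [basisH, List.mem_cons, List.not_mem_nil, or_false] at ha
  rcases ha with rfl | rfl | rfl | rfl | rfl | rfl | rfl | rfl <;>
    simp only [← cnj_cnj, map_cnj, hx, hy, ht, htau, cnj_addRight_genToPerm_t,
      cnj_addRight_genToPerm_tau] <;>
    exact ⟨_, rfl⟩

/-- The affine action of `H` on `ℤ⁵`. -/
def toPerm : H →* Equiv.Perm (Fin 5 → ℤ) := PresentedGroup.toGroup (f := genToPerm) <| by
  rintro r ((h | ⟨a, ha, b, hb, rfl⟩) | rfl)
  · rcases h with rfl | rfl | rfl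
    · simp [ft, pow_two, genToPerm_t_mul_self]
    · simp [ftau, pow_two, genToPerm_tau_mul_self]
    · simp only [ft, ftau, map_mul, map_inv, FreeGroup.lift_apply_of]
      rw [mul_assoc, ← genToPerm_t_mul_tau]
      group
  · obtain ⟨u, hu⟩ := exists_lift_genToPerm_eq_addRight ha
    obtain ⟨v, hv⟩ := exists_lift_genToPerm_eq_addRight hb
    simp only [map_mul, map_inv, hu, hv]
    rw [mul_assoc, ← mul_inv_rev, mul_inv_eq_one, addRight_mul_addRight, addRight_mul_addRight,
      add_comm]
  · simp only [fx, fy, ft, ftau, map_mul, map_inv, map_cnj, FreeGroup.lift_apply_of]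
    rw [mul_inv_eq_one]
    change Equiv.addRight _ * cnj (Equiv.addRight _) _ =
      Equiv.addRight _ * cnj (Equiv.addRight _) _
    rw [cnj_addRight_genToPerm_t, cnj_addRight_genToPerm_tau, addRight_mul_addRight,
      addRight_mul_addRight]
    refine congrArg Equiv.addRight (funext fun i => ?_)
    fin_cases i <;> simp [actT, actTau]

/-! ### The normal subgroup generated by the conjugates of `x` and `y` -/

lemma Ht_sq : Ht ^ 2 = 1 :=
  PresentedGroup.one_of_mem (rels := relsH) (x := ft ^ 2) (by simp [relsH])

lemma Htau_sq : Htau ^ 2 = 1 :=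
  PresentedGroup.one_of_mem (rels := relsH) (x := ftau ^ 2) (by simp [relsH])

lemma commute_Ht_Htau : Commute Ht Htau := by
  have h : Htau⁻¹ * Ht⁻¹ * Htau * Ht = 1 :=
    PresentedGroup.one_of_mem (rels := relsH) (x := ftau⁻¹ * ft⁻¹ * ftau * ft) (by simp [relsH])
  rw [mul_assoc, ← mul_inv_rev, inv_mul_eq_one] at h
  exact h

lemma Hx_mul_cnj : Hx * cnj Hx Htau = Hy * cnj Hy Ht := by
  have h : Hx * cnj Hx Htau * (Hy * cnj Hy Ht)⁻¹ = 1 :=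
    PresentedGroup.one_of_mem (rels := relsH) (x := fx * cnj fx ftau * (fy * cnj fy ft)⁻¹)
      (by simp [relsH])
  exact mul_inv_eq_one.mp h

/-- The section `V → H` of the projection. -/
def sectionV : V →* H := kleinLift Ht Htau Ht_sq Htau_sq commute_Ht_Htau

lemma sectionV_vt : sectionV vt = Ht := by
  change Ht ^ (1 : ZMod 2).val * Htau ^ (0 : ZMod 2).val = Ht
  simp [ZMod.val_one]

lemma sectionV_vtau : sectionV vtau = Htau := by
  change Ht ^ (0 : ZMod 2).val * Htau ^ (1 : ZMod 2).val = Htau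
  simp [ZMod.val_one]

lemma eq_one_or_vt_or_vtau_or_mul (v : V) : v = 1 ∨ v = vt ∨ v = vtau ∨ v = vt * vtau := by
  revert v; decide

/-- The conjugates of `x` and `y` by the elements of the section. -/
def conjugates : Set H := {a | ∃ v : V, a = cnj Hx (sectionV v) ∨ a = cnj Hy (sectionV v)}

lemma exists_basisH_of_mem_conjugates {a : H} (ha : a ∈ conjugates) :
    ∃ b ∈ basisH, PresentedGroup.mk relsH b = a := by
  have hx : PresentedGroup.mk relsH fx = Hx := rfl
  have hy : PresentedGroup.mk relsH fy = Hy := rfl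
  have ht : PresentedGroup.mk relsH ft = Ht := rfl
  have htau : PresentedGroup.mk relsH ftau = Htau := rfl
  obtain ⟨v, rfl | rfl⟩ := ha <;>
    rcases eq_one_or_vt_or_vtau_or_mul v with rfl | rfl | rfl | rfl <;>
    simp [basisH, map_cnj, sectionV_vt, sectionV_vtau, cnj_one, hx, hy, ht, htau]

lemma mul_comm_of_mem_conjugates :
    ∀ a ∈ conjugates, ∀ b ∈ conjugates, a * b = b * a := by
  intro a ha b hb
  obtain ⟨a, ha', rfl⟩ := exists_basisH_of_mem_conjugates ha
  obtain ⟨b, hb', rfl⟩ := exists_basisH_of_mem_conjugates hb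
  have h : PresentedGroup.mk relsH (a * b * a⁻¹ * b⁻¹) = 1 :=
    PresentedGroup.one_of_mem (.inl (.inr ⟨a, ha', b, hb', rfl⟩))
  simp only [map_mul, map_inv] at h
  rwa [mul_assoc, ← mul_inv_rev, mul_inv_eq_one] at h

/-- The subgroup of `H` generated by the conjugates of `x` and `y`. -/
abbrev translations : Subgroup H := Subgroup.closure conjugates

instance : CommGroup translations :=
  { (inferInstance : Group translations) with
    mul_comm := (Subgroup.isMulCommutative_closure mul_comm_of_mem_conjugates).is_comm.comm }

lemma cnj_sectionV_mem {a : H} (ha : a ∈ translations) (v : V) :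
    cnj a (sectionV v) ∈ translations := by
  induction ha using Subgroup.closure_induction with
  | mem a ha =>
    obtain ⟨w, rfl | rfl⟩ := ha
    · exact Subgroup.subset_closure ⟨w * v, .inl (by rw [cnj_cnj, map_mul])⟩
    · exact Subgroup.subset_closure ⟨w * v, .inr (by rw [cnj_cnj, map_mul])⟩
  | one => simp [cnj]
  | mul a b _ _ ha hb => rw [mul_cnj]; exact mul_mem ha hb
  | inv a _ ha =>
    have : cnj a⁻¹ (sectionV v) = (cnj a (sectionV v))⁻¹ := by simp [cnj, mul_assoc]
    rw [this]; exact inv_mem ha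

lemma cnj_Hx_mem (v : V) : cnj Hx (sectionV v) ∈ translations :=
  Subgroup.subset_closure ⟨v, .inl rfl⟩

lemma cnj_Hy_mem (v : V) : cnj Hy (sectionV v) ∈ translations :=
  Subgroup.subset_closure ⟨v, .inr rfl⟩

lemma Hx_mem : Hx ∈ translations := by simpa [cnj_one] using cnj_Hx_mem 1

lemma Hy_mem : Hy ∈ translations := by simpa [cnj_one] using cnj_Hy_mem 1

lemma sectionV_mem_normalizer (v : V) :
    sectionV v ∈ Subgroup.normalizer (translations : Set H) := by
  rw [Subgroup.mem_normalizer_iff]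
  refine fun a => ⟨fun ha => ?_, fun ha => ?_⟩
  · simpa [cnj] using cnj_sectionV_mem ha v⁻¹
  · simpa [cnj, mul_assoc] using cnj_sectionV_mem ha v

instance : translations.Normal := by
  rw [← Subgroup.normalizer_eq_top_iff, eq_top_iff, ← PresentedGroup.closure_range_of,
    Subgroup.closure_le]
  rintro _ ⟨g, rfl⟩
  cases g with
  | x => exact Subgroup.le_normalizer Hx_mem
  | y => exact Subgroup.le_normalizer Hy_mem
  | t => exact (sectionV_vt ▸ sectionV_mem_normalizer vt : Ht ∈ _)
  | tau => exact (sectionV_vtau ▸ sectionV_mem_normalizer vtau : Htau ∈ _)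

lemma toV_Hx : toV Hx = 1 := PresentedGroup.toGroup.of _

lemma toV_Hy : toV Hy = 1 := PresentedGroup.toGroup.of _

lemma toV_Ht : toV Ht = vt := PresentedGroup.toGroup.of _

lemma toV_Htau : toV Htau = vtau := PresentedGroup.toGroup.of _

lemma mk_eq_mk_sectionV_toV :
    QuotientGroup.mk' translations =
      (QuotientGroup.mk' translations).comp (sectionV.comp toV) := by
  refine PresentedGroup.ext fun g => ?_
  cases g with
  | x =>
    change QuotientGroup.mk' _ Hx = QuotientGroup.mk' _ (sectionV (toV Hx))
    rw [toV_Hx, map_one, map_one]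
    exact (QuotientGroup.eq_one_iff _).mpr Hx_mem
  | y =>
    change QuotientGroup.mk' _ Hy = QuotientGroup.mk' _ (sectionV (toV Hy))
    rw [toV_Hy, map_one, map_one]
    exact (QuotientGroup.eq_one_iff _).mpr Hy_mem
  | t =>
    change QuotientGroup.mk' _ Ht = QuotientGroup.mk' _ (sectionV (toV Ht))
    rw [toV_Ht, sectionV_vt]
  | tau =>
    change QuotientGroup.mk' _ Htau = QuotientGroup.mk' _ (sectionV (toV Htau))
    rw [toV_Htau, sectionV_vtau]

lemma ker_toV : toV.ker = translations := by
  apply le_antisymm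
  · intro h hh
    have := DFunLike.congr_fun mk_eq_mk_sectionV_toV h
    rw [MonoidHom.comp_apply, MonoidHom.comp_apply, MonoidHom.mem_ker.mp hh, map_one,
      map_one] at this
    exact (QuotientGroup.eq_one_iff _).mp this
  · rw [Subgroup.closure_le]
    rintro _ ⟨v, rfl | rfl⟩ <;> simp [MonoidHom.mem_ker, toV_Hx, toV_Hy, cnj]

/-! ### The basis of the kernel -/

/-- The five elements `x`, `x^t`, `y`, `y^τ`, `x * x^τ`. -/
def kernelBasis : Fin 5 → translations :=
  ![⟨_, cnj_Hx_mem 1⟩, ⟨_, cnj_Hx_mem vt⟩, ⟨_, cnj_Hy_mem 1⟩, ⟨_, cnj_Hy_mem vtau⟩,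
    ⟨_, cnj_Hx_mem 1⟩ * ⟨_, cnj_Hx_mem vtau⟩]

/-- The homomorphism `ℤ⁵ → H` given by `kernelBasis`. -/
def fromZ5 : Multiplicative (Fin 5 → ℤ) →* H := translations.subtype.comp (zpowProdHom kernelBasis)

lemma toPerm_fromZ5 (m : Multiplicative (Fin 5 → ℤ)) :
    toPerm (fromZ5 m) = Equiv.addRight m.toAdd := by
  have hx : toPerm Hx = Equiv.addRight ![1, 0, 0, 0, 0] := PresentedGroup.toGroup.of _
  have hy : toPerm Hy = Equiv.addRight ![0, 0, 1, 0, 0] := PresentedGroup.toGroup.of _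
  have ht : toPerm Ht = genToPerm .t := PresentedGroup.toGroup.of _
  have htau : toPerm Htau = genToPerm .tau := PresentedGroup.toGroup.of _
  have h : fromZ5 m = Hx ^ m.toAdd 0 * cnj Hx Ht ^ m.toAdd 1 * Hy ^ m.toAdd 2 *
      cnj Hy Htau ^ m.toAdd 3 * (Hx * cnj Hx Htau) ^ m.toAdd 4 := by
    rw [← sectionV_vt, ← sectionV_vtau]
    nth_rw 1 3 [← cnj_one Hx]
    nth_rw 1 [← cnj_one Hy]
    rw [← map_one sectionV]
    change ((∏ i, kernelBasis i ^ m.toAdd i : translations) : H) = _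
    rw [Fin.prod_univ_five]
    rfl
  rw [h]
  simp only [map_mul, map_zpow, map_cnj, hx, hy, ht, htau, cnj_addRight_genToPerm_t,
    cnj_addRight_genToPerm_tau, addRight_zpow, addRight_mul_addRight]
  refine congrArg Equiv.addRight (funext fun i => ?_)
  fin_cases i <;> simp [actT, actTau]

lemma fromZ5_injective : Function.Injective fromZ5 := fun m n h => by
  have h' := congrArg toPerm h
  rw [toPerm_fromZ5, toPerm_fromZ5] at h'
  simpa using DFunLike.congr_fun h' 0

lemma cnj_mul_cnj (v : V) :
    cnj Hx (sectionV v) * cnj Hx (sectionV (vtau * v)) =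
      cnj Hy (sectionV v) * cnj Hy (sectionV (vt * v)) := by
  have h := congrArg (cnj · (sectionV v)) Hx_mul_cnj
  simpa only [mul_cnj, cnj_cnj, ← sectionV_vt, ← sectionV_vtau, ← map_mul] using h

lemma conjugates_subset_range : conjugates ⊆ (fromZ5.range : Set H) := by
  have hmem (i) : (kernelBasis i : H) ∈ fromZ5.range := by
    obtain ⟨m, hm⟩ := mem_range_zpowProdHom kernelBasis i
    exact ⟨m, congrArg Subtype.val hm⟩
  have hvv : vt * vt = 1 := by decide
  have hww : vtau * vtau = 1 := by decide
  have hwv : vtau * vt = vt * vtau := by decide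
  have x1 : cnj Hx (sectionV 1) ∈ fromZ5.range := hmem 0
  have xt : cnj Hx (sectionV vt) ∈ fromZ5.range := hmem 1
  have y1 : cnj Hy (sectionV 1) ∈ fromZ5.range := hmem 2
  have yu : cnj Hy (sectionV vtau) ∈ fromZ5.range := hmem 3
  have s : cnj Hx (sectionV 1) * cnj Hx (sectionV vtau) ∈ fromZ5.range := hmem 4
  have xu := (Subgroup.mul_mem_cancel_left _ x1).mp s
  have r1 := cnj_mul_cnj 1
  have rt := cnj_mul_cnj vt
  have ru := cnj_mul_cnj vtau
  rw [mul_one, mul_one] at r1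
  rw [hvv, hwv] at rt
  rw [hww] at ru
  have yt := (Subgroup.mul_mem_cancel_left _ y1).mp (r1 ▸ s)
  have xtu := (Subgroup.mul_mem_cancel_left _ xt).mp (rt ▸ mul_mem yt y1)
  have ytu := (Subgroup.mul_mem_cancel_left _ yu).mp (ru ▸ mul_mem xu x1)
  rintro _ ⟨v, rfl | rfl⟩ <;>
    rcases eq_one_or_vt_or_vtau_or_mul v with rfl | rfl | rfl | rfl <;> assumption

lemma range_fromZ5 : fromZ5.range = translations := by
  apply le_antisymm
  · rintro _ ⟨m, rfl⟩
    exact (zpowProdHom kernelBasis m).2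
  · exact (Subgroup.closure_le _).mpr conjugates_subset_range

lemma toV_surjective : Function.Surjective toV := fun v => by
  refine ⟨sectionV v, ?_⟩
  rcases eq_one_or_vt_or_vtau_or_mul v with rfl | rfl | rfl | rfl <;>
    simp [sectionV_vt, sectionV_vtau, toV_Ht, toV_Htau]

end NS

open NS in
/-- The surjective homomorphism `H → V` sending `x, y` to the identity and `t, τ` to the
two generators of the Klein four-group `V` has kernel a free abelian group of rank 5;
in particular there is a short exact sequence `1 → ℤ⁵ → H → V → 1`. -/
theorem kernel_of_H_to_Klein_four_is_free_abelian_rank_five :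
    ∃ φ : H →* V,
      (φ Hx = 1 ∧ φ Hy = 1 ∧ φ Ht = vt ∧ φ Htau = vtau) ∧
      Function.Surjective φ ∧
      Nonempty (MonoidHom.ker φ ≃* Multiplicative (Fin 5 → ℤ)) := by
  exact ⟨toV, ⟨toV_Hx, toV_Hy, toV_Ht, toV_Htau⟩, toV_surjective,
    ⟨(MulEquiv.subgroupCongr (ker_toV.trans range_fromZ5.symm)).trans
      (MonoidHom.ofInjective fromZ5_injective).symm⟩⟩
end

section
/- If h ∈ H lies in the kernel N of the natural map H → V onto the Klein four-group but h does not lie in the subgroup of H generated by x and y, then ℓ(h) ≥ |ε(h)| + 2. -/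
namespace NS

theorem evalH_cons (p : GenH × Bool) (w : Word GenH) :
    evalH (p :: w) =
      (if p.2 then (PresentedGroup.of p.1 : H) else (PresentedGroup.of p.1)⁻¹) * evalH w := by
  simp [evalH, evalWith]

theorem wlenH_cons (p : GenH × Bool) (w : Word GenH) : wlenH (p :: w) = wtH p + wlenH w := by
  simp [wlenH]

/-- Every element of `H` is the value of a word. -/
theorem evalH_surjective : Function.Surjective evalH := by
  intro h
  obtain ⟨f, rfl⟩ := PresentedGroup.mk_surjective relsH h
  obtain ⟨w, rfl⟩ := Quot.exists_rep f
  refine ⟨w, ?_⟩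
  change _ = PresentedGroup.mk relsH (FreeGroup.mk w)
  induction w with
  | nil => exact (map_one _).symm
  | cons p w ih =>
    have hp : FreeGroup.mk (p :: w) = FreeGroup.mk [p] * FreeGroup.mk w := by
      simp [FreeGroup.mul_mk]
    rw [evalH_cons, ih, hp, map_mul]
    obtain ⟨a, _ | _⟩ := p
    · have ha : FreeGroup.mk [(a, false)] = (FreeGroup.of a)⁻¹ := by
        simp [FreeGroup.of, FreeGroup.inv_mk, FreeGroup.invRev]
      rw [ha, map_inv]
      rfl
    · rfl

/-- The length `ℓ(h)` is attained by some word. -/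
theorem exists_evalH_eq_wlenH_eq_ellH (h : H) :
    ∃ w : Word GenH, evalH w = h ∧ wlenH w = ellH h := by
  obtain ⟨w, hw⟩ := evalH_surjective h
  exact Nat.sInf_mem (s := {n | ∃ w : Word GenH, evalH w = h ∧ wlenH w = n}) ⟨_, w, hw, rfl⟩

/-- The bounds on the length `n` of a word with value `k`, according to whether its letters
`t^{±1}, τ^{±1}` have total length at least two, are absent, or are a single `t^{±1}`. -/
def LengthTrichotomy (φ : H →* V) (ε : H →* Multiplicative ℤ) (k : H) (n : ℤ) : Prop :=
  |Multiplicative.toAdd (ε k)| + 2 ≤ n ∨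
    (k ∈ Subgroup.closure {Hx, Hy} ∧ |Multiplicative.toAdd (ε k)| ≤ n) ∨
    (φ k = vt ∧ |Multiplicative.toAdd (ε k)| + 1 ≤ n)

theorem wlenH_trichotomy
    (φ : H →* V) (hφx : φ Hx = 1) (hφy : φ Hy = 1) (hφt : φ Ht = vt)
    (ε : H →* Multiplicative ℤ)
    (hεx : ε Hx = Multiplicative.ofAdd 1) (hεy : ε Hy = Multiplicative.ofAdd 1)
    (hεt : ε Ht = 1) (hετ : ε Htau = 1) (w : Word GenH) :
    LengthTrichotomy φ ε (evalH w) (wlenH w) := by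
  have hker : Subgroup.closure {Hx, Hy} ≤ φ.ker := by
    rw [Subgroup.closure_le]
    rintro _ (rfl | rfl) <;> simpa [MonoidHom.mem_ker]
  have mul_of_mem (g k : H) (n : ℤ) (hg : g ∈ Subgroup.closure {Hx, Hy})
      (hε : |Multiplicative.toAdd (ε g)| = 1)
      (hk : LengthTrichotomy φ ε k n) :
      LengthTrichotomy φ ε (g * k) (1 + n) := by
    have habs : |Multiplicative.toAdd (ε (g * k))| ≤ 1 + |Multiplicative.toAdd (ε k)| := by
      rw [map_mul, toAdd_mul, ← hε]
      exact abs_add_le _ _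
    rcases hk with hk | ⟨hk, hl⟩ | ⟨hk, hl⟩
    · left; linarith
    · exact .inr (.inl ⟨mul_mem hg hk, by linarith⟩)
    · refine .inr (.inr ⟨?_, by linarith⟩)
      rw [map_mul, MonoidHom.mem_ker.1 (hker hg), one_mul, hk]
  have hx : Hx ∈ Subgroup.closure {Hx, Hy} := Subgroup.subset_closure (by simp)
  have hy : Hy ∈ Subgroup.closure {Hx, Hy} := Subgroup.subset_closure (by simp)
  have mul_of_map_eq_vt (g k : H) (n : ℤ) (hg : φ g = vt) (hε : ε g = 1)
      (hk : LengthTrichotomy φ ε k n) :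
      LengthTrichotomy φ ε (g * k) (1 + n) := by
    rw [LengthTrichotomy, map_mul ε, hε, one_mul]
    rcases hk with hk | ⟨hk, hl⟩ | ⟨hk, hl⟩
    · left; linarith
    · refine .inr (.inr ⟨?_, by linarith⟩)
      rw [map_mul, MonoidHom.mem_ker.1 (hker hk), mul_one, hg]
    · left; linarith
  induction w with
  | nil => exact .inr (.inl ⟨by simp [evalH, evalWith, one_mem], by simp [evalH, evalWith]⟩)
  | cons p w ih =>
    rw [evalH_cons, wlenH_cons, Nat.cast_add]
    rcases p with ⟨_ | _ | _ | _, _ | _⟩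
    · exact mul_of_mem Hx⁻¹ _ _ (inv_mem hx) (by simp [hεx]) ih
    · exact mul_of_mem Hx _ _ hx (by simp [hεx]) ih
    · exact mul_of_mem Hy⁻¹ _ _ (inv_mem hy) (by simp [hεy]) ih
    · exact mul_of_mem Hy _ _ hy (by simp [hεy]) ih
    · exact mul_of_map_eq_vt Ht⁻¹ _ _ (by rw [map_inv, hφt]; decide) (by simp [hεt]) ih
    · exact mul_of_map_eq_vt Ht _ _ hφt hεt ih
    · left
      change |Multiplicative.toAdd (ε (Htau⁻¹ * evalH w))| + 2 ≤ 2 + (wlenH w : ℤ)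
      rw [map_mul, map_inv, hετ, inv_one, one_mul]
      rcases ih with h | ⟨_, h⟩ | ⟨_, h⟩ <;> linarith
    · left
      change |Multiplicative.toAdd (ε (Htau * evalH w))| + 2 ≤ 2 + (wlenH w : ℤ)
      rw [map_mul, hετ, one_mul]
      rcases ih with h | ⟨_, h⟩ | ⟨_, h⟩ <;> linarith

end NS

open NS in
/-- If `h ∈ H` lies in the kernel `N` of the natural map `H → V` onto the Klein
four-group but not in the subgroup generated by `x` and `y`, then `ℓ(h) ≥ |ε(h)| + 2`. -/
theorem ell_ge_abs_epsilon_add_two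
    (φ : H →* V) (hφx : φ Hx = 1) (hφy : φ Hy = 1) (hφt : φ Ht = vt) (hφτ : φ Htau = vtau)
    (ε : H →* Multiplicative ℤ)
    (hεx : ε Hx = Multiplicative.ofAdd 1) (hεy : ε Hy = Multiplicative.ofAdd 1)
    (hεt : ε Ht = 1) (hετ : ε Htau = 1)
    (h : H) (hh : h ∈ MonoidHom.ker φ) (hnot : h ∉ Subgroup.closure {Hx, Hy}) :
    |Multiplicative.toAdd (ε h)| + 2 ≤ (ellH h : ℤ) := by
  obtain ⟨w, rfl, hw⟩ := exists_evalH_eq_wlenH_eq_ellH h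
  rw [← hw]
  rcases wlenH_trichotomy φ hφx hφy hφt ε hεx hεy hεt hετ w with h | ⟨h, _⟩ | ⟨h, _⟩
  · exact h
  · exact absurd h hnot
  · exact absurd (h.symm.trans hh) (by decide)
end
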